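/- Let A ∈ ℂ^{n×n} be a negative definite Hermitian matrix and p ≤ n. Let Q_p ∈ ℂ^{n×p} have orthonormal columns that are eigenvectors of A corresponding to the p smallest eigenvalues of A (counted with multiplicity), with A Q_p = Q_p Λ_p, and let V ∈ ℂ^{p×p} be any unitary matrix. Then X = Q_p V^* lies in OB(n,p), satisfies E0(Q_p V^*) = tr(Λ_p), and is a global minimizer of E0 over OB(n,p): E0(Y) ≥ tr(Λ_p) for every Y ∈ OB(n,p). In particular, every local minimum of E0 over OB(n,p) equals the global minimum tr(Λ_p). -/

import Mathlib

open Matrix Finset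

noncomputable section

/-- The oblique manifold `OB(n,p)`: complex `n × p` matrices all of whose columns have
unit norm, i.e. every diagonal entry of `Xᴴ * X` equals `1`. -/
def OBset (n p : ℕ) : Set (Matrix (Fin n) (Fin p) ℂ) :=
  {X | ∀ j, (Xᴴ * X) j j = 1}

/-- Frobenius norm of a complex matrix. -/
def frobNorm {n p : ℕ} (X : Matrix (Fin n) (Fin p) ℂ) : ℝ :=
  Real.sqrt (∑ i, ∑ j, Complex.normSq (X i j))

/-- The eigenvalues of a Hermitian matrix, listed in nondecreasing order
(counted with multiplicity). -/
def sortedEig {n : ℕ} {A : Matrix (Fin n) (Fin n) ℂ} (hA : A.IsHermitian) : Fin n → ℝ :=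
  fun i => hA.eigenvalues (Tuple.sort hA.eigenvalues i)

/-- The qOMM objective `E0(X) = tr((2I − X*X)(X*AX))` (a real number since `A` is Hermitian). -/
def E0 {n p : ℕ} (A : Matrix (Fin n) (Fin n) ℂ) (X : Matrix (Fin n) (Fin p) ℂ) : ℝ :=
  ((((2 : ℂ) • (1 : Matrix (Fin p) (Fin p) ℂ)) - Xᴴ * X) * (Xᴴ * A * X)).trace.re

/-- A function `t ↦ a t + b t² + r(t) t³` with `r` continuous at `0` that is nonnegative near `0`
has `a = 0` and `0 ≤ b`. -/
lemma order_conditions_of_eventually_nonneg {a b : ℝ} {r : ℝ → ℝ} (hr : ContinuousAt r 0)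
    (h : ∀ᶠ t in nhds (0 : ℝ), 0 ≤ t * a + t ^ 2 * b + t ^ 3 * r t) : a = 0 ∧ 0 ≤ b := by
  have hq : Filter.Tendsto (fun t => a + t * b + t ^ 2 * r t) (nhds 0) (nhds a) := by
    have : ContinuousAt (fun t => a + t * b + t ^ 2 * r t) 0 := by fun_prop
    simpa [ContinuousAt] using this
  have hb : Filter.Tendsto (fun t => b + t * r t) (nhds 0) (nhds b) := by
    have : ContinuousAt (fun t => b + t * r t) 0 := by fun_prop
    simpa [ContinuousAt] using this
  have ha : a = 0 := by
    apply le_antisymm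
    · refine le_of_tendsto (hq.mono_left (nhdsWithin_le_nhds (s := Set.Iio 0))) ?_
      filter_upwards [h.filter_mono nhdsWithin_le_nhds, self_mem_nhdsWithin] with t ht ht0
      have ht0 : t < 0 := ht0
      by_contra! hc
      nlinarith [mul_neg_of_neg_of_pos ht0 hc]
    · refine ge_of_tendsto (hq.mono_left (nhdsWithin_le_nhds (s := Set.Ioi 0))) ?_
      filter_upwards [h.filter_mono nhdsWithin_le_nhds, self_mem_nhdsWithin] with t ht ht0
      have ht0 : 0 < t := ht0
      by_contra! hc
      nlinarith [mul_neg_of_pos_of_neg ht0 hc]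
  refine ⟨ha, ge_of_tendsto (hb.mono_left (nhdsWithin_le_nhds (s := Set.Ioi 0))) ?_⟩
  filter_upwards [h.filter_mono nhdsWithin_le_nhds, self_mem_nhdsWithin] with t ht ht0
  have ht0 : 0 < t := ht0
  by_contra! hc
  nlinarith [mul_neg_of_pos_of_neg (pow_pos ht0 2) hc]

/-- The objective depends on `X` only through `X * Xᴴ`. -/
lemma E0_eq {n p : ℕ} (A : Matrix (Fin n) (Fin n) ℂ) (X : Matrix (Fin n) (Fin p) ℂ) :
    E0 A X = (A * ((2 : ℂ) • (X * Xᴴ) - X * Xᴴ * (X * Xᴴ))).trace.re := by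
  have h1 : (Xᴴ * A * X).trace = (A * (X * Xᴴ)).trace := by
    rw [Matrix.mul_assoc, trace_mul_comm, Matrix.mul_assoc]
  have h2 : (Xᴴ * X * (Xᴴ * A * X)).trace = (A * (X * Xᴴ * (X * Xᴴ))).trace := by
    rw [trace_mul_comm, Matrix.mul_assoc Xᴴ A X, Matrix.mul_assoc Xᴴ (A * X), trace_mul_comm]
    simp only [Matrix.mul_assoc]
  simp only [E0, Matrix.sub_mul, Matrix.mul_sub, Matrix.smul_mul, Matrix.mul_smul, trace_sub,
    trace_smul, Matrix.one_mul, h1, h2]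

/-- The derivative at `P` of `P ↦ tr (A (2P - P²))`, as a matrix. -/
def gradMat {n : ℕ} (A P : Matrix (Fin n) (Fin n) ℂ) : Matrix (Fin n) (Fin n) ℂ :=
  (2 : ℂ) • A - A * P - P * A

lemma trace_quadratic_add {n : ℕ} (A P Δ : Matrix (Fin n) (Fin n) ℂ) :
    (A * ((2 : ℂ) • (P + Δ) - (P + Δ) * (P + Δ))).trace =
      (A * ((2 : ℂ) • P - P * P)).trace + (gradMat A P * Δ).trace - (A * (Δ * Δ)).trace := by
  have h : (A * (Δ * P)).trace = (P * A * Δ).trace := by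
    rw [← Matrix.mul_assoc, trace_mul_comm, Matrix.mul_assoc]
  simp only [gradMat, Matrix.mul_sub, Matrix.mul_add, Matrix.add_mul, Matrix.sub_mul, trace_sub,
    trace_add, Matrix.mul_smul, Matrix.smul_mul, smul_add, h, trace_smul, Matrix.mul_assoc]
  ring

/-- Squared norms of the columns of `U`. -/
def colSq {n p : ℕ} (U : Matrix (Fin n) (Fin p) ℂ) (j : Fin p) : ℝ := ∑ i, Complex.normSq (U i j)

lemma conjTranspose_mul_self_diag {n p : ℕ} (U : Matrix (Fin n) (Fin p) ℂ) (j : Fin p) :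
    (Uᴴ * U) j j = (colSq U j : ℂ) := by
  simp [Matrix.mul_apply, colSq, Complex.normSq_eq_conj_mul_self]

lemma colSq_nonneg {n p : ℕ} (U : Matrix (Fin n) (Fin p) ℂ) (j : Fin p) : 0 ≤ colSq U j :=
  Finset.sum_nonneg fun _ _ => Complex.normSq_nonneg _

/-- The curve `t ↦ Z + t U` with its columns normalised, for `U` tangent at `Z`. -/
def obCurve {n p : ℕ} (Z U : Matrix (Fin n) (Fin p) ℂ) (t : ℝ) : Matrix (Fin n) (Fin p) ℂ :=
  (Z + (t : ℂ) • U) * diagonal fun j => (((Real.sqrt (1 + t ^ 2 * colSq U j))⁻¹ : ℝ) : ℂ)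

lemma one_add_colSq_pos {n p : ℕ} (U : Matrix (Fin n) (Fin p) ℂ) (t : ℝ) (j : Fin p) :
    0 < 1 + t ^ 2 * colSq U j := by
  have := colSq_nonneg U j
  positivity

lemma obCurve_mem {n p : ℕ} {Z U : Matrix (Fin n) (Fin p) ℂ} (hZ : Z ∈ OBset n p)
    (hU : ∀ j, (Zᴴ * U) j j = 0) (t : ℝ) : obCurve Z U t ∈ OBset n p := by
  intro j
  have hU' : (Uᴴ * Z) j j = 0 := by
    have := congrArg star (hU j)
    rw [← conjTranspose_apply, conjTranspose_mul, conjTranspose_conjTranspose] at this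
    simpa using this
  have hs := one_add_colSq_pos U t j
  have hZj := hZ j
  have key : ((Z + (t : ℂ) • U)ᴴ * (Z + (t : ℂ) • U)) j j = ((1 + t ^ 2 * colSq U j : ℝ) : ℂ) := by
    simp only [conjTranspose_add, conjTranspose_smul, Matrix.add_mul, Matrix.mul_add,
      Matrix.smul_mul, Matrix.mul_smul, Matrix.add_apply, Matrix.smul_apply, hZj, hU, hU',
      conjTranspose_mul_self_diag U j]
    simp
    ring
  rw [obCurve, conjTranspose_mul, diagonal_conjTranspose, Matrix.mul_assoc, diagonal_mul,
    ← Matrix.mul_assoc, mul_diagonal, key]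
  simp only [Pi.star_apply, Complex.star_def, Complex.conj_ofReal]
  norm_cast
  have h2 := Real.sq_sqrt hs.le
  have h3 := Real.sqrt_pos.2 hs
  field_simp
  exact h2.symm

lemma continuous_obCurve {n p : ℕ} (Z U : Matrix (Fin n) (Fin p) ℂ) :
    Continuous (obCurve Z U) := by
  have h : ∀ j, Continuous fun t : ℝ => (Real.sqrt (1 + t ^ 2 * colSq U j))⁻¹ := fun j =>
    Continuous.inv₀ (by fun_prop) fun t => (Real.sqrt_pos.2 (one_add_colSq_pos U t j)).ne'
  unfold obCurve
  refine Continuous.matrix_mul (by fun_prop) (Continuous.matrix_diagonal ?_)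
  exact continuous_pi fun j => Complex.continuous_ofReal.comp (h j)

lemma obCurve_zero {n p : ℕ} (Z U : Matrix (Fin n) (Fin p) ℂ) : obCurve Z U 0 = Z := by
  simp [obCurve]

lemma continuous_frobNorm {n p : ℕ} :
    Continuous (frobNorm : Matrix (Fin n) (Fin p) ℂ → ℝ) := by
  unfold frobNorm
  refine Real.continuous_sqrt.comp (continuous_finsetSum _ fun i _ =>
    continuous_finsetSum _ fun j _ => Complex.continuous_normSq.comp ?_)
  exact continuous_id.matrix_elem i j

lemma obCurve_mul_conjTranspose {n p : ℕ} (Z U : Matrix (Fin n) (Fin p) ℂ) (t : ℝ) :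
    obCurve Z U t * (obCurve Z U t)ᴴ = Z * Zᴴ + (t : ℂ) • ((Z * Uᴴ + U * Zᴴ) + (t : ℂ) •
      ((U * Uᴴ - Z * diagonal (fun j => (colSq U j : ℂ)) * Zᴴ) + (t : ℂ) •
        ((t : ℂ) • ((Z + (t : ℂ) • U) * diagonal (fun j =>
            ((colSq U j ^ 2 / (1 + t ^ 2 * colSq U j) : ℝ) : ℂ)) * (Z + (t : ℂ) • U)ᴴ
            - U * diagonal (fun j => (colSq U j : ℂ)) * Uᴴ)
          - (U * diagonal (fun j => (colSq U j : ℂ)) * Zᴴ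
            + Z * diagonal (fun j => (colSq U j : ℂ)) * Uᴴ)))) := by
  set N := diagonal (fun j => (colSq U j : ℂ))
  set M := diagonal (fun j => ((colSq U j ^ 2 / (1 + t ^ 2 * colSq U j) : ℝ) : ℂ)) with hM
  have hE : (diagonal fun j => (((Real.sqrt (1 + t ^ 2 * colSq U j))⁻¹ : ℝ) : ℂ)) *
      (diagonal fun j => (((Real.sqrt (1 + t ^ 2 * colSq U j))⁻¹ : ℝ) : ℂ))ᴴ =
      1 - ((t : ℂ) ^ 2) • N + ((t : ℂ) ^ 4) • M := by
    rw [diagonal_conjTranspose, diagonal_mul_diagonal, ← diagonal_one, ← diagonal_smul,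
      ← diagonal_smul, diagonal_sub, diagonal_add]
    congr 1
    ext j
    simp only [Pi.star_apply, Complex.star_def, Complex.conj_ofReal, Pi.smul_apply, smul_eq_mul]
    norm_cast
    have hs := one_add_colSq_pos U t j
    rw [← mul_inv, Real.mul_self_sqrt hs.le]
    field_simp
    ring
  rw [obCurve, conjTranspose_mul, Matrix.mul_assoc, ← Matrix.mul_assoc (diagonal _), hE]
  simp only [conjTranspose_add, conjTranspose_smul, Matrix.add_mul, Matrix.mul_add, Matrix.sub_mul,
    Matrix.mul_sub, Matrix.smul_mul, Matrix.mul_smul, Matrix.one_mul, smul_add, smul_sub, smul_smul,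
    Complex.star_def, Complex.conj_ofReal, Matrix.mul_assoc]
  module

/-- `Z` minimizes the objective among nearby points of the oblique manifold. -/
def IsLocMin {n p : ℕ} (A : Matrix (Fin n) (Fin n) ℂ) (Z : Matrix (Fin n) (Fin p) ℂ) : Prop :=
  ∃ δ > (0 : ℝ), ∀ Y ∈ OBset n p, frobNorm (Y - Z) < δ → E0 A Z ≤ E0 A Y

lemma order_conditions_of_isLocMin {n p : ℕ} {A : Matrix (Fin n) (Fin n) ℂ}
    {Z U : Matrix (Fin n) (Fin p) ℂ} (hZ : Z ∈ OBset n p) (hloc : IsLocMin A Z)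
    (hU : ∀ j, (Zᴴ * U) j j = 0) :
    (gradMat A (Z * Zᴴ) * (Z * Uᴴ + U * Zᴴ)).trace.re = 0 ∧
    0 ≤ (gradMat A (Z * Zᴴ) *
        (U * Uᴴ - Z * diagonal (fun j => (colSq U j : ℂ)) * Zᴴ)).trace.re -
      (A * ((Z * Uᴴ + U * Zᴴ) * (Z * Uᴴ + U * Zᴴ))).trace.re := by
  obtain ⟨δ, hδ, hmin⟩ := hloc
  have hev : ∀ᶠ t in nhds (0 : ℝ), E0 A Z ≤ E0 A (obCurve Z U t) := by
    have hc : Continuous fun t => frobNorm (obCurve Z U t - Z) :=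
      continuous_frobNorm.comp ((continuous_obCurve Z U).sub continuous_const)
    have h0 : frobNorm (obCurve Z U 0 - Z) < δ := by
      simpa [obCurve_zero, frobNorm] using hδ
    filter_upwards [hc.continuousAt.eventually_lt_const h0] with t ht
    exact hmin _ (obCurve_mem hZ hU t) ht
  set P1 := Z * Uᴴ + U * Zᴴ
  set P2 := U * Uᴴ - Z * diagonal (fun j => (colSq U j : ℂ)) * Zᴴ
  set K := gradMat A (Z * Zᴴ)
  set R : ℝ → Matrix (Fin n) (Fin n) ℂ := fun t =>
    (t : ℂ) • ((Z + (t : ℂ) • U) * diagonal (fun j =>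
            ((colSq U j ^ 2 / (1 + t ^ 2 * colSq U j) : ℝ) : ℂ)) * (Z + (t : ℂ) • U)ᴴ
            - U * diagonal (fun j => (colSq U j : ℂ)) * Uᴴ)
          - (U * diagonal (fun j => (colSq U j : ℂ)) * Zᴴ
            + Z * diagonal (fun j => (colSq U j : ℂ)) * Uᴴ) with hR
  have hcurve : ∀ t, obCurve Z U t * (obCurve Z U t)ᴴ =
      Z * Zᴴ + (t : ℂ) • (P1 + (t : ℂ) • (P2 + (t : ℂ) • R t)) :=
    obCurve_mul_conjTranspose Z U
  have hRc : Continuous R := by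
    have h : Continuous fun t : ℝ => diagonal (fun j =>
        ((colSq U j ^ 2 / (1 + t ^ 2 * colSq U j) : ℝ) : ℂ)) :=
      Continuous.matrix_diagonal (continuous_pi fun j => Complex.continuous_ofReal.comp
        (Continuous.div (by fun_prop) (by fun_prop) fun t => (one_add_colSq_pos U t j).ne'))
    simp only [hR]
    fun_prop
  clear_value R
  refine order_conditions_of_eventually_nonneg (r := fun t => (K * R t).trace.re -
    (A * (P1 * (P2 + (t : ℂ) • R t) + (P2 + (t : ℂ) • R t) * P1)).trace.re -
    t * (A * ((P2 + (t : ℂ) • R t) * (P2 + (t : ℂ) • R t))).trace.re) ?_ ?_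
  · apply Continuous.continuousAt
    have hre := Complex.continuous_re
    refine Continuous.sub (Continuous.sub (hre.comp (Continuous.matrix_trace (by fun_prop)))
      (hre.comp (Continuous.matrix_trace (by fun_prop)))) (continuous_id.mul
      (hre.comp (Continuous.matrix_trace (by fun_prop))))
  · filter_upwards [hev] with t ht
    rw [E0_eq, E0_eq, hcurve, trace_quadratic_add, Complex.sub_re, Complex.add_re] at ht
    have h1 : (K * ((t : ℂ) • (P1 + (t : ℂ) • (P2 + (t : ℂ) • R t)))).trace.re =
        t * (K * P1).trace.re + t ^ 2 * (K * P2).trace.re + t ^ 3 * (K * R t).trace.re := by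
      simp only [Matrix.mul_add, Matrix.mul_smul, trace_add, trace_smul, smul_eq_mul,
        Complex.add_re, Complex.re_ofReal_mul]
      ring
    have h2 : ∀ G : Matrix (Fin n) (Fin n) ℂ,
        (A * ((t : ℂ) • (P1 + (t : ℂ) • G) * ((t : ℂ) • (P1 + (t : ℂ) • G)))).trace.re =
        t ^ 2 * (A * (P1 * P1)).trace.re + t ^ 3 * (A * (P1 * G + G * P1)).trace.re +
          t ^ 4 * (A * (G * G)).trace.re := by
      intro G
      simp only [Matrix.mul_add, Matrix.add_mul, Matrix.mul_smul, Matrix.smul_mul, smul_add,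
        trace_add, trace_smul, smul_eq_mul, Complex.add_re, Complex.re_ofReal_mul]
      ring
    rw [h1, h2] at ht
    refine (sub_nonneg.2 ht).trans_eq ?_
    ring

lemma gradMat_isHermitian {n : ℕ} {A P : Matrix (Fin n) (Fin n) ℂ} (hA : A.IsHermitian)
    (hP : P.IsHermitian) : (gradMat A P).IsHermitian := by
  unfold Matrix.IsHermitian gradMat
  simp only [conjTranspose_sub, conjTranspose_mul, conjTranspose_smul, hA.eq, hP.eq, star_ofNat]
  abel

/-- The Lagrange multipliers of a critical point. -/
def multMat {n p : ℕ} (A : Matrix (Fin n) (Fin n) ℂ) (Z : Matrix (Fin n) (Fin p) ℂ) :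
    Matrix (Fin p) (Fin p) ℂ :=
  diagonal fun j => (Zᴴ * gradMat A (Z * Zᴴ) * Z) j j

open scoped ComplexOrder in
lemma gradMat_mul_eq_of_isLocMin {n p : ℕ} {A : Matrix (Fin n) (Fin n) ℂ} (hA : A.IsHermitian)
    {Z : Matrix (Fin n) (Fin p) ℂ} (hZ : Z ∈ OBset n p) (hloc : IsLocMin A Z) :
    gradMat A (Z * Zᴴ) * Z = Z * multMat A Z := by
  have hK := gradMat_isHermitian hA (isHermitian_mul_conjTranspose_self Z)
  set K := gradMat A (Z * Zᴴ) with hKdef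
  set U := K * Z - Z * multMat A Z with hUdef
  have hZU : ∀ j, (Zᴴ * U) j j = 0 := by
    intro j
    rw [hUdef, Matrix.mul_sub, Matrix.sub_apply, ← Matrix.mul_assoc, ← Matrix.mul_assoc, multMat,
      mul_diagonal, hZ j, one_mul, sub_self]
  have hUZ : ∀ j, (Uᴴ * Z) j j = 0 := by
    intro j
    have := congrArg star (hZU j)
    rw [← conjTranspose_apply, conjTranspose_mul, conjTranspose_conjTranspose] at this
    simpa using this
  have h1 := (order_conditions_of_isLocMin hZ hloc hZU).1
  have h2 : (K * (U * Zᴴ)).trace = star (K * (Z * Uᴴ)).trace := by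
    rw [← trace_conjTranspose]
    simp only [conjTranspose_mul, conjTranspose_conjTranspose, hK.eq]
    rw [trace_mul_comm]
  have h3 : (K * (Z * Uᴴ)).trace = (Uᴴ * U).trace := by
    have : (Uᴴ * (Z * multMat A Z)).trace = 0 := by
      rw [← Matrix.mul_assoc, multMat, trace]
      simp [mul_diagonal, hUZ]
    have h4 : K * Z = U + Z * multMat A Z := by rw [hUdef]; abel
    rw [← Matrix.mul_assoc, trace_mul_comm, h4, Matrix.mul_add, trace_add, this, add_zero]
  rw [← hKdef, Matrix.mul_add, trace_add, h2, h3, Complex.add_re] at h1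
  have h5 : (Uᴴ * U).trace.re = ∑ j, colSq U j := by
    simp [trace, conjTranspose_mul_self_diag]
  have h6 : ∑ j, colSq U j = 0 := by
    rw [← h5]
    simp only [Complex.star_def, Complex.conj_re] at h1
    linarith
  have h7 : (Uᴴ * U).trace = 0 := by
    simp only [trace, diag_apply, conjTranspose_mul_self_diag]
    exact_mod_cast h6
  exact sub_eq_zero.1 (trace_conjTranspose_mul_self_eq_zero_iff.1 h7)

lemma trace_mul_vecMulVec_star {n : ℕ} (M : Matrix (Fin n) (Fin n) ℂ) (x y : Fin n → ℂ) :
    (M * vecMulVec x (star y)).trace = star y ⬝ᵥ M *ᵥ x := by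
  rw [mul_vecMulVec, trace_vecMulVec, dotProduct_comm]

/-- The second order condition at a local minimizer, in the direction `w vᴴ` with `w` orthogonal
to the range of `Z`. -/
lemma second_order_of_isLocMin {n p : ℕ} {A : Matrix (Fin n) (Fin n) ℂ} (hA : A.IsHermitian)
    {Z : Matrix (Fin n) (Fin p) ℂ} (hZ : Z ∈ OBset n p) (hloc : IsLocMin A Z)
    {w : Fin n → ℂ} (hw : Zᴴ *ᵥ w = 0) (v : Fin p → ℂ) :
    0 ≤ (2 * (star v ⬝ᵥ v) * (star w ⬝ᵥ A *ᵥ w) - (star w ⬝ᵥ w) * (star v ⬝ᵥ multMat A Z *ᵥ v)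
      - (star w ⬝ᵥ w) * (star (Z *ᵥ v) ⬝ᵥ A *ᵥ (Z *ᵥ v))
      - (star (Z *ᵥ v) ⬝ᵥ (Z *ᵥ v)) * (star w ⬝ᵥ A *ᵥ w)).re := by
  have hw' : star w ᵥ* Z = 0 := by
    have := congrArg star hw
    rwa [star_mulVec, conjTranspose_conjTranspose, star_zero] at this
  set U := vecMulVec w (star v) with hU
  have hUH : Uᴴ = vecMulVec v (star w) := by
    rw [hU, conjTranspose_vecMulVec, star_star]
  have hZU : ∀ j, (Zᴴ * U) j j = 0 := by
    intro j
    rw [hU, mul_vecMulVec, hw]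
    simp [vecMulVec_apply]
  have h := (order_conditions_of_isLocMin hZ hloc hZU).2
  have hKZ := gradMat_mul_eq_of_isLocMin hA hZ hloc
  set y := Z *ᵥ v with hy
  have hwy : star w ⬝ᵥ y = 0 := by rw [hy, dotProduct_mulVec, hw', zero_dotProduct]
  have hyw : star y ⬝ᵥ w = 0 := by
    rw [star_dotProduct, hwy, star_zero]
  have hP1 : Z * Uᴴ + U * Zᴴ = vecMulVec y (star w) + vecMulVec w (star y) := by
    rw [hUH, hU, mul_vecMulVec, vecMulVec_mul, hy, star_mulVec]
  have hUU : U * Uᴴ = (star v ⬝ᵥ v) • vecMulVec w (star w) := by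
    rw [hUH, hU, vecMulVec_mul_vecMulVec, vecMulVec_smul]
  have h1 : (gradMat A (Z * Zᴴ) * (U * Uᴴ)).trace =
      2 * (star v ⬝ᵥ v) * (star w ⬝ᵥ A *ᵥ w) := by
    rw [hUU, Matrix.mul_smul, trace_smul, trace_mul_vecMulVec_star, gradMat, sub_mulVec, sub_mulVec,
      dotProduct_sub, dotProduct_sub, smul_mulVec, ← mulVec_mulVec, ← mulVec_mulVec,
      ← mulVec_mulVec, ← mulVec_mulVec, hw, dotProduct_mulVec _ Z, hw']
    simp
    ring
  have h2 : (gradMat A (Z * Zᴴ) * (Z * diagonal (fun j => (colSq U j : ℂ)) * Zᴴ)).trace =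
      (star w ⬝ᵥ w) * (star v ⬝ᵥ multMat A Z *ᵥ v) := by
    have hN : ∀ j, (colSq U j : ℂ) = (star w ⬝ᵥ w) * (v j * star (v j)) := by
      intro j
      rw [← conjTranspose_mul_self_diag, hUH, hU, vecMulVec_mul_vecMulVec]
      simp [vecMulVec_apply]
      ring
    rw [← Matrix.mul_assoc, ← Matrix.mul_assoc, hKZ, trace_mul_comm, ← Matrix.mul_assoc,
      ← Matrix.mul_assoc, multMat, trace,
      show star v ⬝ᵥ _ = ∑ j, _ from rfl, Finset.mul_sum]
    refine Finset.sum_congr rfl fun j _ => ?_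
    rw [diag_apply, mul_diagonal, mul_diagonal, hZ j, hN, mulVec_diagonal]
    simp
    ring
  have h3 : (A * ((Z * Uᴴ + U * Zᴴ) * (Z * Uᴴ + U * Zᴴ))).trace =
      (star w ⬝ᵥ w) * (star y ⬝ᵥ A *ᵥ y) + (star y ⬝ᵥ y) * (star w ⬝ᵥ A *ᵥ w) := by
    rw [hP1]
    simp only [Matrix.add_mul, Matrix.mul_add, vecMulVec_mul_vecMulVec, hwy, hyw, zero_smul,
      vecMulVec_zero, vecMulVec_smul, Matrix.mul_smul, trace_add, trace_smul,
      trace_mul_vecMulVec_star, smul_eq_mul, Matrix.mul_zero, trace_zero]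
    ring
  rw [Matrix.mul_sub, trace_sub, h1, h2, h3, ← Complex.sub_re] at h
  convert h using 2
  ring

lemma exists_unitary_diagonalization {m : ℕ} {H : Matrix (Fin m) (Fin m) ℂ} (hH : H.IsHermitian)
    (σ : Equiv.Perm (Fin m)) : ∃ V : Matrix (Fin m) (Fin m) ℂ, Vᴴ * V = 1 ∧ V * Vᴴ = 1 ∧
      H * V = V * diagonal fun j => (hH.eigenvalues (σ j) : ℂ) := by
  set W : Matrix (Fin m) (Fin m) ℂ := hH.eigenvectorUnitary.1 with hW
  have hWW : Wᴴ * W = 1 := mem_unitaryGroup_iff'.1 hH.eigenvectorUnitary.2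
  have hV : (W.submatrix id σ)ᴴ * W.submatrix id σ = 1 := by
    have h : (W.submatrix id σ)ᴴ * W.submatrix id σ = (Wᴴ * W).submatrix σ σ := rfl
    rw [h, hWW, submatrix_one_equiv]
  refine ⟨W.submatrix id σ, hV, mul_eq_one_comm.1 hV, ?_⟩
  ext i j
  have h := congrFun (hH.mulVec_eigenvectorBasis (σ j)) i
  rw [mul_diagonal]
  simp only [mulVec, dotProduct, Pi.smul_apply, Complex.real_smul] at h
  simp only [mul_apply, submatrix_apply, id, hW, IsHermitian.eigenvectorUnitary_apply]
  rw [h, mul_comm]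

lemma conjTranspose_mul_mul_apply {n p : ℕ} (M : Matrix (Fin n) (Fin n) ℂ)
    (V : Matrix (Fin n) (Fin p) ℂ) (i j : Fin p) :
    (Vᴴ * M * V) i j = star (V.col i) ⬝ᵥ M *ᵥ V.col j := by
  rw [Matrix.mul_assoc, mul_apply]
  rfl

lemma star_mulVec_dotProduct {n p : ℕ} (Z : Matrix (Fin n) (Fin p) ℂ) (v : Fin p → ℂ)
    (x : Fin n → ℂ) : star (Z *ᵥ v) ⬝ᵥ x = star v ⬝ᵥ Zᴴ *ᵥ x := by
  rw [star_mulVec, dotProduct_mulVec]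

lemma star_dotProduct_self_eq {n : ℕ} (x : Fin n → ℂ) :
    star x ⬝ᵥ x = ((∑ i, Complex.normSq (x i) : ℝ) : ℂ) := by
  simp [dotProduct, Complex.normSq_eq_conj_mul_self]

lemma sum_normSq_pos {n : ℕ} {x : Fin n → ℂ} (hx : x ≠ 0) : 0 < ∑ i, Complex.normSq (x i) := by
  obtain ⟨i, hi⟩ := Function.ne_iff.1 hx
  exact Finset.sum_pos' (fun _ _ => Complex.normSq_nonneg _)
    ⟨i, Finset.mem_univ _, Complex.normSq_pos.2 hi⟩

open scoped ComplexOrder in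
/-- If `Z` has at most as many columns as rows and a nontrivial kernel, some nonzero vector is
orthogonal to its range. -/
lemma exists_ne_zero_conjTranspose_mulVec_eq_zero {n p : ℕ} (hpn : p ≤ n)
    {Z : Matrix (Fin n) (Fin p) ℂ} {v : Fin p → ℂ} (hv : v ≠ 0) (hZv : Z *ᵥ v = 0) :
    ∃ w : Fin n → ℂ, w ≠ 0 ∧ Zᴴ *ᵥ w = 0 := by
  by_contra! hc
  have hinj : LinearMap.ker Zᴴ.mulVecLin = ⊥ := by
    rw [LinearMap.ker_eq_bot']
    intro w hw
    by_contra hw0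
    exact hc w hw0 hw
  have h1 := LinearMap.finrank_range_add_finrank_ker Zᴴ.mulVecLin
  have h2 := LinearMap.finrank_range_add_finrank_ker Z.mulVecLin
  have h3 : Module.finrank ℂ (LinearMap.range Zᴴ.mulVecLin) =
      Module.finrank ℂ (LinearMap.range Z.mulVecLin) := rank_conjTranspose Z
  have h4 : 0 < Module.finrank ℂ (LinearMap.ker Z.mulVecLin) := by
    rw [Module.finrank_pos_iff_exists_ne_zero]
    exact ⟨⟨v, hZv⟩, fun h => hv (congrArg Subtype.val h)⟩
  rw [hinj, finrank_bot] at h1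
  simp only [Module.finrank_fin_fun] at h1 h2
  omega

/-- The columns of a local minimizer are orthonormal. -/
lemma conjTranspose_mul_self_eq_one_of_isLocMin {n p : ℕ} (hpn : p ≤ n)
    {A : Matrix (Fin n) (Fin n) ℂ} (hA : A.IsHermitian)
    (hneg : ∀ z : Fin n → ℂ, z ≠ 0 → (star z ⬝ᵥ A.mulVec z).re < 0)
    {Z : Matrix (Fin n) (Fin p) ℂ} (hZ : Z ∈ OBset n p) (hloc : IsLocMin A Z) :
    Zᴴ * Z = 1 := by
  have hKZ := gradMat_mul_eq_of_isLocMin hA hZ hloc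
  set D := multMat A Z with hD
  set S := Zᴴ * Z with hS
  set H := Zᴴ * A * Z with hH
  have hSD : (2 : ℂ) • H - H * S - S * H = S * D := by
    have := congrArg (Zᴴ * ·) hKZ
    simp only [gradMat, Matrix.mul_sub, Matrix.sub_mul, Matrix.mul_smul, Matrix.smul_mul,
      ← Matrix.mul_assoc] at this
    simpa only [hS, hH, ← Matrix.mul_assoc] using this
  have htr : ((S - 1) * D).trace = 0 := by
    rw [Matrix.sub_mul, trace_sub, Matrix.one_mul, hD, multMat, trace, trace, sub_eq_zero]
    refine Finset.sum_congr rfl fun j _ => ?_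
    rw [diag_apply, diag_apply, mul_diagonal, diagonal_apply_eq, hS, hZ j, one_mul]
  obtain ⟨V, hV, hV', hSV⟩ := exists_unitary_diagonalization
    (isHermitian_conjTranspose_mul_self Z) (Equiv.refl _)
  set s := (isHermitian_conjTranspose_mul_self Z).eigenvalues
  simp only [Equiv.refl_apply, ← hS] at hSV
  set E : Matrix (Fin p) (Fin p) ℂ := diagonal fun j => (s j : ℂ) with hE
  have hSE : S = V * E * Vᴴ := by rw [← hSV, Matrix.mul_assoc, hV', Matrix.mul_one]
  have hVS : Vᴴ * S = E * Vᴴ := by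
    rw [hSE, ← Matrix.mul_assoc, ← Matrix.mul_assoc, hV, Matrix.one_mul]
  have hdiag : (2 : ℂ) • (Vᴴ * H * V) - (Vᴴ * H * V) * E - E * (Vᴴ * H * V) =
      E * (Vᴴ * D * V) := by
    calc _ = Vᴴ * ((2 : ℂ) • H - H * S - S * H) * V := by
          simp only [Matrix.mul_sub, Matrix.sub_mul, Matrix.mul_smul, Matrix.smul_mul]
          congr 1
          · congr 1
            rw [Matrix.mul_assoc _ V E, ← hSV]
            simp only [Matrix.mul_assoc]
          · rw [← Matrix.mul_assoc Vᴴ S H, hVS]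
            simp only [Matrix.mul_assoc]
      _ = _ := by
          rw [hSD, ← Matrix.mul_assoc, hVS]
          simp only [Matrix.mul_assoc]
  have htr' : ∑ i, (s i - 1) * ((Vᴴ * D * V) i i).re = 0 := by
    have h : ((S - 1) * D).trace = ((E - 1) * (Vᴴ * D * V)).trace := by
      have h1 : S - 1 = V * (E - 1) * Vᴴ := by
        rw [Matrix.mul_sub, Matrix.sub_mul, ← hSE, Matrix.mul_one, hV']
      rw [h1, Matrix.mul_assoc, Matrix.mul_assoc, trace_mul_comm]
      simp only [Matrix.mul_assoc]
    rw [h] at htr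
    have h2 := congrArg Complex.re htr
    rw [trace, Complex.re_sum, Complex.zero_re] at h2
    rw [← h2]
    refine Finset.sum_congr rfl fun i _ => ?_
    rw [diag_apply, Matrix.sub_mul, Matrix.sub_apply, hE, diagonal_mul, Matrix.one_mul,
      Complex.sub_re, Complex.re_ofReal_mul]
    ring
  have hi : ∀ i, 0 ≤ (s i - 1) * ((Vᴴ * D * V) i i).re ∧
      ((s i - 1) * ((Vᴴ * D * V) i i).re = 0 → s i = 1) := by
    intro i
    have h1 : 2 * ((Vᴴ * H * V) i i).re * (1 - s i) = s i * ((Vᴴ * D * V) i i).re := by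
      have := congrArg Complex.re (congrFun (congrFun hdiag i) i)
      simp only [hE, Matrix.sub_apply, Matrix.smul_apply, mul_diagonal, diagonal_mul,
        Complex.sub_re, Complex.ofReal_re, Complex.ofReal_im, smul_eq_mul, Complex.mul_re,
        Complex.re_ofNat, Complex.im_ofNat] at this
      linarith
    set v := V.col i with hv
    have hvv : star v ⬝ᵥ v = 1 := by
      have := conjTranspose_mul_mul_apply (1 : Matrix (Fin p) (Fin p) ℂ) V i i
      rw [Matrix.mul_one, hV, one_apply_eq, one_mulVec] at this
      exact this.symm
    have hHv : (Vᴴ * H * V) i i = star (Z *ᵥ v) ⬝ᵥ A *ᵥ (Z *ᵥ v) := by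
      rw [conjTranspose_mul_mul_apply, star_mulVec_dotProduct, hH, mulVec_mulVec, mulVec_mulVec,
        Matrix.mul_assoc]
    have hsv : (s i : ℂ) = star (Z *ᵥ v) ⬝ᵥ (Z *ᵥ v) := by
      rw [star_mulVec_dotProduct, mulVec_mulVec, ← hS, hv, ← conjTranspose_mul_mul_apply, hVS,
        Matrix.mul_assoc, hV, Matrix.mul_one, hE, diagonal_apply_eq]
    by_cases hZv : Z *ᵥ v = 0
    · have hs0 : s i = 0 := by
        rw [hZv, dotProduct_zero] at hsv
        exact_mod_cast hsv
      have hv0 : v ≠ 0 := by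
        rintro h0
        simp [h0] at hvv
      obtain ⟨w, hw0, hw⟩ := exists_ne_zero_conjTranspose_mulVec_eq_zero hpn hv0 hZv
      have h2 := second_order_of_isLocMin hA hZ hloc hw v
      have hwA := hneg w hw0
      have hwp := sum_normSq_pos hw0
      rw [hvv, hZv, star_dotProduct_self_eq w, ← hD, hv, ← conjTranspose_mul_mul_apply] at h2
      simp only [mulVec_zero, dotProduct_zero, mul_zero, sub_zero, mul_one, zero_mul,
        Complex.sub_re, Complex.ofReal_re, Complex.ofReal_im, Complex.mul_re, Complex.re_ofNat,
        Complex.im_ofNat] at h2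
      have hd : ((Vᴴ * D * V) i i).re < 0 := by
        by_contra! hc
        nlinarith [mul_nonneg hwp.le hc]
      rw [hs0]
      constructor
      · linarith
      · intro h; linarith
    · have hh := hneg _ hZv
      rw [← hHv] at hh
      have hsp : 0 < s i := by
        have h2 := sum_normSq_pos hZv
        rw [star_dotProduct_self_eq] at hsv
        rw [Complex.ofReal_injective hsv]
        exact h2
      have h3 : s i * ((s i - 1) * ((Vᴴ * D * V) i i).re) =
          -(2 * ((Vᴴ * H * V) i i).re) * (1 - s i) ^ 2 := by
        linear_combination (-(s i - 1)) * h1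
      constructor
      · have : 0 ≤ s i * ((s i - 1) * ((Vᴴ * D * V) i i).re) := by
          rw [h3]
          exact mul_nonneg (by linarith) (sq_nonneg _)
        exact nonneg_of_mul_nonneg_right this hsp
      · intro h
        rw [h, mul_zero] at h3
        rcases mul_eq_zero.1 h3.symm with h4 | h4
        · linarith
        · nlinarith [pow_eq_zero_iff (two_ne_zero) |>.1 h4]
  have hone : ∀ i, s i = 1 := fun i => (hi i).2
    ((Finset.sum_eq_zero_iff_of_nonneg fun i _ => (hi i).1).1 htr' i (Finset.mem_univ _))
  rw [hSE, hE]
  simp [hone, hV']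

lemma E0_of_orthonormal {n p : ℕ} (A : Matrix (Fin n) (Fin n) ℂ)
    {Z : Matrix (Fin n) (Fin p) ℂ} (hZ : Zᴴ * Z = 1) : E0 A Z = (Zᴴ * A * Z).trace.re := by
  rw [E0, hZ]
  congr 2
  rw [Matrix.sub_mul, Matrix.smul_mul, Matrix.one_mul, two_smul, add_sub_cancel_right]

lemma E0_of_eigenvectors {n p : ℕ} {A : Matrix (Fin n) (Fin n) ℂ}
    {Z : Matrix (Fin n) (Fin p) ℂ} (hZ : Zᴴ * Z = 1) {η : Fin p → ℝ}
    (hAZ : A * Z = Z * diagonal fun j => (η j : ℂ)) : E0 A Z = ∑ j, η j := by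
  rw [E0_of_orthonormal A hZ, Matrix.mul_assoc, hAZ, ← Matrix.mul_assoc, hZ, Matrix.one_mul,
    trace_diagonal]
  simp

lemma mem_OBset_of_orthonormal {n p : ℕ} {Z : Matrix (Fin n) (Fin p) ℂ} (hZ : Zᴴ * Z = 1) :
    Z ∈ OBset n p := fun j => by rw [hZ, one_apply_eq]

lemma E0_mul_of_unitary {n p : ℕ} (A : Matrix (Fin n) (Fin n) ℂ) (Z : Matrix (Fin n) (Fin p) ℂ)
    {V : Matrix (Fin p) (Fin p) ℂ} (hV : V * Vᴴ = 1) : E0 A (Z * V) = E0 A Z := by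
  have h : Z * V * (Z * V)ᴴ = Z * Zᴴ := by
    rw [conjTranspose_mul, Matrix.mul_assoc, ← Matrix.mul_assoc V, hV, Matrix.one_mul]
  rw [E0_eq, E0_eq, h]

lemma orthonormal_mul_of_unitary {n p : ℕ} {Z : Matrix (Fin n) (Fin p) ℂ} (hZ : Zᴴ * Z = 1)
    {V : Matrix (Fin p) (Fin p) ℂ} (hV : Vᴴ * V = 1) : (Z * V)ᴴ * (Z * V) = 1 := by
  rw [conjTranspose_mul, Matrix.mul_assoc, ← Matrix.mul_assoc Zᴴ, hZ, Matrix.one_mul, hV]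

/-- Eigenvectors whose eigenvalues lie below the values of the quadratic form on the orthogonal
complement minimize the trace of `Qᴴ A Q` among orthonormal frames. -/
lemma sum_le_E0_of_orthonormal {n p : ℕ} (hp : 0 < p) {A : Matrix (Fin n) (Fin n) ℂ}
    (hA : A.IsHermitian) {Z : Matrix (Fin n) (Fin p) ℂ} (hZ : Zᴴ * Z = 1) {η : Fin p → ℝ}
    (hAZ : A * Z = Z * diagonal fun j => (η j : ℂ))
    (hperp : ∀ j, ∀ w : Fin n → ℂ, Zᴴ *ᵥ w = 0 →
      η j * (star w ⬝ᵥ w).re ≤ (star w ⬝ᵥ A *ᵥ w).re)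
    {Q : Matrix (Fin n) (Fin p) ℂ} (hQ : Qᴴ * Q = 1) : ∑ j, η j ≤ E0 A Q := by
  set N : Matrix (Fin p) (Fin p) ℂ := diagonal fun j => (η j : ℂ) with hN
  have hNH : Nᴴ = N := by
    rw [hN, diagonal_conjTranspose]
    congr 1
    ext j
    simp
  have hZA : Zᴴ * A = N * Zᴴ := by
    have := congrArg conjTranspose hAZ
    rwa [conjTranspose_mul, conjTranspose_mul, hA.eq, hNH] at this
  obtain ⟨C, hC⟩ : ∃ C, C = Zᴴ * Q := ⟨_, rfl⟩
  obtain ⟨W, hW⟩ : ∃ W, W = Q - Z * C := ⟨_, rfl⟩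
  have hZW : Zᴴ * W = 0 := by
    rw [hW, Matrix.mul_sub, ← Matrix.mul_assoc, hZ, Matrix.one_mul, hC, sub_self]
  have hWZ : Wᴴ * Z = 0 := by
    have := congrArg conjTranspose hZW
    rwa [conjTranspose_mul, conjTranspose_conjTranspose, conjTranspose_zero] at this
  have hQW : Q = Z * C + W := by rw [hW]; abel
  have hQAQ : Qᴴ * A * Q = Cᴴ * N * C + Wᴴ * A * W := by
    have h1 : Cᴴ * Zᴴ * A * Z * C = Cᴴ * N * C := by
      rw [Matrix.mul_assoc Cᴴ, hZA, ← Matrix.mul_assoc, Matrix.mul_assoc _ Zᴴ Z, hZ, Matrix.mul_one]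
    have h2 : Cᴴ * Zᴴ * A * W = 0 := by
      rw [Matrix.mul_assoc Cᴴ, hZA, Matrix.mul_assoc, Matrix.mul_assoc N, hZW, Matrix.mul_zero,
        Matrix.mul_zero]
    have h3 : Wᴴ * A * Z * C = 0 := by
      rw [Matrix.mul_assoc Wᴴ, hAZ, ← Matrix.mul_assoc, hWZ, Matrix.zero_mul, Matrix.zero_mul]
    rw [hQW, conjTranspose_add, conjTranspose_mul]
    simp only [Matrix.add_mul, Matrix.mul_add, ← Matrix.mul_assoc, h1, h2, h3]
    simp
  have hWW : Cᴴ * C + Wᴴ * W = 1 := by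
    have h1 : Cᴴ * Zᴴ * Z * C = Cᴴ * C := by
      rw [Matrix.mul_assoc Cᴴ, hZ, Matrix.mul_one]
    have h2 : Cᴴ * Zᴴ * W = 0 := by rw [Matrix.mul_assoc, hZW, Matrix.mul_zero]
    rw [← hQ, hQW, conjTranspose_add, conjTranspose_mul]
    simp only [Matrix.add_mul, Matrix.mul_add, ← Matrix.mul_assoc, h1, h2, hWZ]
    simp
  set c : Fin p → ℝ := fun j => ((C * Cᴴ) j j).re with hc
  have hc1 : ∀ j, c j ≤ 1 := by
    intro j
    have h : C * Cᴴ + (Z - Q * Cᴴ)ᴴ * (Z - Q * Cᴴ) = 1 := by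
      have hCH : Cᴴ = Qᴴ * Z := by rw [hC, conjTranspose_mul, conjTranspose_conjTranspose]
      rw [conjTranspose_sub, conjTranspose_mul, conjTranspose_conjTranspose, Matrix.sub_mul,
        Matrix.mul_sub, Matrix.mul_sub, hZ, ← Matrix.mul_assoc Zᴴ, ← hC, Matrix.mul_assoc C Qᴴ Z,
        ← hCH, Matrix.mul_assoc C Qᴴ, ← Matrix.mul_assoc Qᴴ, hQ, Matrix.one_mul]
      abel
    have h' := congrArg Complex.re (congrFun (congrFun h j) j)
    rw [Matrix.add_apply, conjTranspose_mul_self_diag, one_apply_eq, Complex.add_re,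
      Complex.ofReal_re, Complex.one_re] at h'
    have := colSq_nonneg (Z - Q * Cᴴ) j
    change ((C * Cᴴ) j j).re ≤ 1
    linarith
  have hCNC : (Cᴴ * N * C).trace.re = ∑ j, η j * c j := by
    rw [Matrix.mul_assoc, trace_mul_comm, Matrix.mul_assoc, trace, Complex.re_sum]
    refine Finset.sum_congr rfl fun j _ => ?_
    rw [diag_apply, hN, diagonal_mul, Complex.re_ofReal_mul]
  have hWWtr : (Wᴴ * W).trace.re = ∑ j, (1 - c j) := by
    have h := congrArg (fun M => (trace M).re) hWW
    simp only [trace_add, trace_one, Complex.add_re] at h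
    rw [trace_mul_comm] at h
    have h2 : (C * Cᴴ).trace.re = ∑ j, c j := by rw [trace, Complex.re_sum]; rfl
    rw [h2] at h
    simp only [Finset.sum_sub_distrib, Finset.sum_const, Finset.card_univ, Fintype.card_fin] at h ⊢
    simp at h ⊢
    linarith
  obtain ⟨k, -, hk⟩ := Finset.exists_max_image Finset.univ η ⟨⟨0, hp⟩, Finset.mem_univ _⟩
  have hWAW : η k * (Wᴴ * W).trace.re ≤ (Wᴴ * A * W).trace.re := by
    rw [trace, trace, Complex.re_sum, Complex.re_sum, Finset.mul_sum]
    refine Finset.sum_le_sum fun j _ => ?_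
    have h := hperp k (W.col j) (by
      ext i
      exact congrFun (congrFun hZW i) j)
    rw [diag_apply, diag_apply, conjTranspose_mul_mul_apply]
    exact h
  rw [E0_of_orthonormal A hQ, hQAQ, trace_add, Complex.add_re, hCNC]
  rw [hWWtr, Finset.mul_sum] at hWAW
  refine le_trans ?_ (add_le_add_right hWAW _)
  rw [← Finset.sum_add_distrib]
  refine Finset.sum_le_sum fun j _ => ?_
  nlinarith [mul_nonneg (sub_nonneg.2 (hk j (Finset.mem_univ _))) (sub_nonneg.2 (hc1 j))]

/-- A local minimizer is at least as good as every orthonormal frame. -/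
lemma E0_le_of_isLocMin {n p : ℕ} (hp : 0 < p) (hpn : p ≤ n)
    {A : Matrix (Fin n) (Fin n) ℂ} (hA : A.IsHermitian)
    (hneg : ∀ z : Fin n → ℂ, z ≠ 0 → (star z ⬝ᵥ A.mulVec z).re < 0)
    {Z : Matrix (Fin n) (Fin p) ℂ} (hZ : Z ∈ OBset n p) (hloc : IsLocMin A Z)
    {Q : Matrix (Fin n) (Fin p) ℂ} (hQ : Qᴴ * Q = 1) : E0 A Z ≤ E0 A Q := by
  have hS := conjTranspose_mul_self_eq_one_of_isLocMin hpn hA hneg hZ hloc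
  have hKZ := gradMat_mul_eq_of_isLocMin hA hZ hloc
  set H := Zᴴ * A * Z with hH
  have hK : gradMat A (Z * Zᴴ) * Z = A * Z - Z * H := by
    simp only [gradMat, Matrix.sub_mul, Matrix.smul_mul, hH, Matrix.mul_assoc, hS, Matrix.mul_one]
    rw [two_smul]
    abel
  have hD : multMat A Z = 0 := by
    have h : Zᴴ * gradMat A (Z * Zᴴ) * Z = 0 := by
      rw [Matrix.mul_assoc, hK, Matrix.mul_sub, ← Matrix.mul_assoc, ← Matrix.mul_assoc, hS,
        Matrix.one_mul, sub_self]
    rw [multMat, h]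
    simp
  have hAZ : A * Z = Z * H := by
    rw [hK, hD, Matrix.mul_zero] at hKZ
    exact sub_eq_zero.1 hKZ
  have hHH : H.IsHermitian := isHermitian_conjTranspose_mul_mul Z hA
  obtain ⟨V, hV, hV', hHV⟩ := exists_unitary_diagonalization hHH (Equiv.refl _)
  set η := hHH.eigenvalues
  simp only [Equiv.refl_apply] at hHV
  have hZV := orthonormal_mul_of_unitary hS hV
  have hAZV : A * (Z * V) = Z * V * diagonal fun j => (η j : ℂ) := by
    rw [← Matrix.mul_assoc, hAZ, Matrix.mul_assoc, hHV, Matrix.mul_assoc]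
  rw [← E0_mul_of_unitary A Z hV', E0_of_eigenvectors hZV hAZV]
  refine sum_le_E0_of_orthonormal hp hA hZV hAZV (fun j w hw => ?_) hQ
  have hZw : Zᴴ *ᵥ w = 0 := by
    have h := congrArg (V *ᵥ ·) hw
    simpa only [conjTranspose_mul, mulVec_mulVec, ← Matrix.mul_assoc, hV', Matrix.one_mul,
      mulVec_zero] using h
  have h := second_order_of_isLocMin hA hZ hloc hZw (V.col j)
  have hvv : star (V.col j) ⬝ᵥ V.col j = 1 := by
    have := conjTranspose_mul_mul_apply (1 : Matrix (Fin p) (Fin p) ℂ) V j j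
    rw [Matrix.mul_one, hV, one_apply_eq, one_mulVec] at this
    exact this.symm
  have hyy : star (Z *ᵥ V.col j) ⬝ᵥ (Z *ᵥ V.col j) = 1 := by
    rw [star_mulVec_dotProduct, mulVec_mulVec, hS, one_mulVec, hvv]
  have hyA : star (Z *ᵥ V.col j) ⬝ᵥ A *ᵥ (Z *ᵥ V.col j) = (η j : ℂ) := by
    rw [star_mulVec_dotProduct, mulVec_mulVec, mulVec_mulVec, ← hH, ← conjTranspose_mul_mul_apply,
      Matrix.mul_assoc, hHV, ← Matrix.mul_assoc, hV, Matrix.one_mul, diagonal_apply_eq]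
  rw [hD, hvv, hyy, hyA, zero_mulVec, dotProduct_zero] at h
  simp only [mul_zero, sub_zero, mul_one, one_mul, Complex.sub_re, Complex.ofReal_re,
    Complex.ofReal_im, Complex.mul_re, Complex.re_ofNat, Complex.im_ofNat, zero_mul] at h
  linarith

/-- The trace minimization principle in terms of the sorted eigenvalues. -/
lemma sum_sortedEig_le_E0 {n p : ℕ} (hp : 0 < p) (hpn : p ≤ n) {A : Matrix (Fin n) (Fin n) ℂ}
    (hA : A.IsHermitian) {Q : Matrix (Fin n) (Fin p) ℂ} (hQ : Qᴴ * Q = 1) :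
    ∑ j : Fin p, sortedEig hA (Fin.castLE hpn j) ≤ E0 A Q := by
  obtain ⟨V, hV, hV', hAV⟩ := exists_unitary_diagonalization hA (Tuple.sort hA.eigenvalues)
  have hmono : Monotone (sortedEig hA) := Tuple.monotone_sort hA.eigenvalues
  change A * V = V * diagonal (fun j => (sortedEig hA j : ℂ)) at hAV
  set ι : Fin p → Fin n := Fin.castLE hpn
  have hι : Function.Injective ι := Fin.castLE_injective hpn
  set Z := V.submatrix id ι with hZdef
  have hZ : Zᴴ * Z = 1 := by
    have h : Zᴴ * Z = (Vᴴ * V).submatrix ι ι := rfl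
    rw [h, hV, submatrix_one _ hι]
  have hAZ : A * Z = Z * diagonal fun j => (sortedEig hA (ι j) : ℂ) := by
    ext i j
    have h := congrFun (congrFun hAV i) (ι j)
    rw [mul_diagonal] at h ⊢
    exact h
  refine sum_le_E0_of_orthonormal hp hA hZ hAZ (fun j w hw => ?_) hQ
  set b := Vᴴ *ᵥ w with hb
  have hwb : w = V *ᵥ b := by rw [hb, mulVec_mulVec, hV', one_mulVec]
  have hb0 : ∀ k : Fin p, b (ι k) = 0 := fun k => congrFun hw k
  have h1 : (star w ⬝ᵥ w).re = ∑ i, Complex.normSq (b i) := by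
    rw [hwb, star_mulVec_dotProduct, mulVec_mulVec, hV, one_mulVec, star_dotProduct_self_eq,
      Complex.ofReal_re]
  have h2 : (star w ⬝ᵥ A *ᵥ w).re = ∑ i, sortedEig hA i * Complex.normSq (b i) := by
    rw [hwb, star_mulVec_dotProduct, mulVec_mulVec, mulVec_mulVec, Matrix.mul_assoc, hAV,
      ← Matrix.mul_assoc, hV, Matrix.one_mul, dotProduct, Complex.re_sum]
    refine Finset.sum_congr rfl fun i _ => ?_
    rw [mulVec_diagonal, mul_left_comm, Complex.re_ofReal_mul, Pi.star_apply, Complex.star_def,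
      ← Complex.normSq_eq_conj_mul_self, Complex.ofReal_re]
  rw [h1, h2, Finset.mul_sum]
  refine Finset.sum_le_sum fun i _ => ?_
  rcases lt_or_ge (i : ℕ) p with hi | hi
  · have : b i = 0 := hb0 ⟨i, hi⟩
    simp [this]
  · refine mul_le_mul_of_nonneg_right (hmono ?_) (Complex.normSq_nonneg _)
    exact Fin.le_def.2 (le_trans j.2.le hi)

lemma isCompact_OBset (n p : ℕ) : IsCompact (OBset n p) := by
  have hclosed : IsClosed (OBset n p) := by
    have h : OBset n p = ⋂ j, {X | (Xᴴ * X) j j = 1} := by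
      ext X
      simp [OBset]
    rw [h]
    refine isClosed_iInter fun j => isClosed_eq ?_ continuous_const
    exact Continuous.matrix_elem (by fun_prop) j j
  refine IsCompact.of_isClosed_subset (isCompact_univ_pi fun _ : Fin n =>
    isCompact_univ_pi fun _ : Fin p => isCompact_closedBall (0 : ℂ) 1) hclosed ?_
  intro X hX i _ j _
  have h := hX j
  rw [conjTranspose_mul_self_diag] at h
  have h1 : colSq X j = 1 := by exact_mod_cast h
  have h2 : Complex.normSq (X i j) ≤ 1 := by
    rw [← h1]
    exact Finset.single_le_sum (f := fun i => Complex.normSq (X i j))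
      (fun _ _ => Complex.normSq_nonneg _) (Finset.mem_univ i)
  rw [mem_closedBall_zero_iff]
  rw [Complex.normSq_eq_norm_sq] at h2
  exact (sq_le_one_iff₀ (norm_nonneg _)).1 h2

lemma continuous_E0 {n p : ℕ} (A : Matrix (Fin n) (Fin n) ℂ) :
    Continuous (E0 A : Matrix (Fin n) (Fin p) ℂ → ℝ) := by
  unfold E0
  exact Complex.continuous_re.comp (Continuous.matrix_trace (by fun_prop))

/-- any `X = Q_p V^*` with `Q_p` orthonormal eigenvectors for the `p`
smallest eigenvalues and `V` unitary lies in `OB(n,p)`, attains `E0 = tr(Λ_p)`, and is a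
global minimizer of `E0` over `OB(n,p)`; in particular every local minimum equals the
global minimum `tr(Λ_p)`. -/
theorem qOMM_global_minimizers {n p : ℕ} (hp : 0 < p) (hpn : p ≤ n)
    (A : Matrix (Fin n) (Fin n) ℂ) (hA : A.IsHermitian)
    (hneg : ∀ z : Fin n → ℂ, z ≠ 0 → (star z ⬝ᵥ A.mulVec z).re < 0)
    (Q : Matrix (Fin n) (Fin p) ℂ) (V : Matrix (Fin p) (Fin p) ℂ)
    (hQ : Qᴴ * Q = 1)
    (hAQ : A * Q = Q * Matrix.diagonal (fun j : Fin p => (sortedEig hA (Fin.castLE hpn j) : ℂ)))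
    (hV : Vᴴ * V = 1) (hV2 : V * Vᴴ = 1) :
    Q * Vᴴ ∈ OBset n p ∧
    E0 A (Q * Vᴴ) = ∑ j : Fin p, sortedEig hA (Fin.castLE hpn j) ∧
    (∀ Y ∈ OBset n p, ∑ j : Fin p, sortedEig hA (Fin.castLE hpn j) ≤ E0 A Y) ∧
    (∀ Z ∈ OBset n p,
      (∃ δ > (0 : ℝ), ∀ Y ∈ OBset n p, frobNorm (Y - Z) < δ → E0 A Z ≤ E0 A Y) →
      E0 A Z = ∑ j : Fin p, sortedEig hA (Fin.castLE hpn j)) := by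
  set L := ∑ j : Fin p, sortedEig hA (Fin.castLE hpn j)
  have hVH : Vᴴ * Vᴴᴴ = 1 := by rw [conjTranspose_conjTranspose, hV]
  have hVH' : Vᴴᴴ * Vᴴ = 1 := by rw [conjTranspose_conjTranspose, hV2]
  have hEQ : E0 A Q = L := E0_of_eigenvectors hQ hAQ
  have hlocal : ∀ Z ∈ OBset n p, IsLocMin A Z → E0 A Z = L := fun Z hZ hloc =>
    le_antisymm (hEQ ▸ E0_le_of_isLocMin hp hpn hA hneg hZ hloc hQ)
      (sum_sortedEig_le_E0 hp hpn hA
        (conjTranspose_mul_self_eq_one_of_isLocMin hpn hA hneg hZ hloc))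
  refine ⟨mem_OBset_of_orthonormal (orthonormal_mul_of_unitary hQ hVH'),
    by rw [E0_mul_of_unitary A Q hVH, hEQ], fun Y hY => ?_, hlocal⟩
  obtain ⟨Z, hZ, hmin⟩ := (isCompact_OBset n p).exists_isMinOn ⟨Y, hY⟩ (continuous_E0 A).continuousOn
  rw [← hlocal Z hZ ⟨1, one_pos, fun X hX _ => hmin hX⟩]
  exact hmin hY
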